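/- arXiv:1902.10386 — 2 statements merged into one kernel-verified Lean document; each statement's English description precedes it below -/
import Mathlib

section
/- Define Ψ : D(A,A) → Der_K(A[X]) by sending (h,u) to the unique K-derivation of A[X] which maps C(a) to C(h(a)) for every a ∈ A and maps X to C(u(1))·X, where C : A → A[X] is the canonical inclusion. Then Ψ is injective, K-linear, A-linear, and a morphism of Lie algebras: Ψ applied to the bracket ([h,h'], u∘u'−u'∘u) equals the commutator Ψ(h,u)∘Ψ(h',u') − Ψ(h',u')∘Ψ(h,u). -/
open Polynomial

/-- A pair `(h, u)` with `h` a `K`-derivation of `A` and `u` a `K`-linear endomorphism of `A`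
is a *derivation of the pair* `(A, A)` if `u (a·b) = h a · b + a · u b` for all `a, b`. -/
def IsPairDerivation {K A : Type*} [CommRing K] [CommRing A] [Algebra K A]
    (h : Derivation K A A) (u : A →ₗ[K] A) : Prop :=
  ∀ a b : A, u (a * b) = h a * b + a * u b

/-- The second component of a derivation of the pair is determined by its value at `1`. -/
theorem IsPairDerivation.apply_eq {K A : Type*} [CommRing K] [CommRing A] [Algebra K A]
    {h : Derivation K A A} {u : A →ₗ[K] A} (hu : IsPairDerivation h u) (a : A) :
    u a = h a + a * u 1 := by
  simpa using hu a 1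

/-- Two `K`-derivations of `A[X]` that agree on constants and on `X` are equal. -/
theorem derivation_ext_of_C_X {K A M : Type*} [CommRing K] [CommRing A] [Algebra K A]
    [AddCommGroup M] [Module K M] [Module A[X] M] {D D' : Derivation K A[X] M}
    (hC : ∀ a, D (C a) = D' (C a)) (hX : D X = D' X) : D = D' := by
  ext p
  induction p using Polynomial.induction_on' with
  | add p q hp hq => rw [map_add, map_add, hp, hq]
  | monomial n a =>
    simp only [← C_mul_X_pow_eq_monomial, Derivation.leibniz, Derivation.leibniz_pow, hC, hX]

/-- The map `Ψ : D(A,A) → Der_K(A[X])` sending `(h,u)` to the unique `K`-derivation of `A[X]`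
with `C a ↦ C (h a)` and `X ↦ C (u 1) · X` is injective, `K`-linear, `A`-linear and a
morphism of Lie algebras. -/
theorem pairDerivation_toLogDerivation {K A : Type*} [Field K] [CharZero K] [CommRing A]
    [Algebra K A]
    (Ψ : Derivation K A A × (A →ₗ[K] A) → Derivation K A[X] A[X])
    (hΨ : ∀ p : Derivation K A A × (A →ₗ[K] A),
      (∀ a : A, Ψ p (C a) = C (p.1 a)) ∧ Ψ p (X : A[X]) = C (p.2 1) * X) :
    Set.InjOn Ψ {p | IsPairDerivation p.1 p.2} ∧
    (∀ p q, Ψ (p + q) = Ψ p + Ψ q) ∧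
    (∀ (k : K) (p), Ψ (k • p) = k • Ψ p) ∧
    (∀ (a : A) (p), Ψ (a • p) = (C a : A[X]) • Ψ p) ∧
    (∀ (h h' : Derivation K A A) (u u' : A →ₗ[K] A),
      IsPairDerivation h u → IsPairDerivation h' u' →
        Ψ (⁅h, h'⁆, u ∘ₗ u' - u' ∘ₗ u) = ⁅Ψ (h, u), Ψ (h', u')⁆) := by
  have hC (p a) : Ψ p (C a) = C (p.1 a) := (hΨ p).1 a
  have hX (p) : Ψ p (X : A[X]) = C (p.2 1) * X := (hΨ p).2
  refine ⟨?_, fun p q => ?_, fun k p => ?_, fun a p => ?_, fun h h' u u' hu hu' => ?_⟩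
  · rintro ⟨h, u⟩ hu ⟨h', u'⟩ hu' heq
    have hh : h = h' := by
      ext a
      exact C_injective (by simpa only [hC] using DFunLike.congr_fun heq (C a))
    have h_one : u 1 = u' 1 := by
      simpa [hX] using congrArg (coeff · 1) (DFunLike.congr_fun heq X)
    have huu : u = u' := by
      ext a
      rw [hu.apply_eq, hu'.apply_eq, hh, h_one]
    rw [hh, huu]
  · refine derivation_ext_of_C_X (fun b => ?_) ?_
    · simp [hC]
    · simp [hX, add_mul]
  · refine derivation_ext_of_C_X (fun b => ?_) ?_
    · simp [hC, smul_C]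
    · simp [hX, ← smul_C]
  · refine derivation_ext_of_C_X (fun b => ?_) ?_
    · simp [hC]
    · simp [hX, mul_assoc]
  · refine derivation_ext_of_C_X (fun b => ?_) ?_
    · simp [hC, Derivation.commutator_apply]
    · simp only [Derivation.commutator_apply, hX, hC, Derivation.leibniz, smul_eq_mul,
        LinearMap.sub_apply, LinearMap.comp_apply, hu.apply_eq (u' 1), hu'.apply_eq (u 1),
        C_sub, C_add, C_mul]
      ring
end

section
/- The map Ψ : D(A,A) → Der_K(A[X]), sending (h,u) to the unique K-derivation of A[X] which maps C(a) to C(h(a)) for every a ∈ A and maps X to C(u(1))·X, is a bijection from D(A,A) onto the set L = {D ∈ Der_K(A[X]) : D(C(a)) ∈ C(A) for all a ∈ A, and D(X) ∈ C(A)·X}, and it preserves the Lie brackets. Hence Ψ is an isomorphism of K-Lie algebras (and of A-modules) from D(A,A) onto L. -/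
open Polynomial

namespace Polynomial

variable {K A : Type*} [CommRing K] [CommRing A] [Algebra K A]

/-- Derivations of `A[X]` over a base ring `K` of `A` are determined by their values on the
constants and on `X`. -/
theorem derivation_ext_C_X {M : Type*} [AddCommMonoid M] [Module A[X] M] [Module K M]
    {D₁ D₂ : Derivation K A[X] M} (hC : ∀ a, D₁ (C a) = D₂ (C a)) (hX : D₁ X = D₂ X) :
    D₁ = D₂ := by
  ext p
  induction p using Polynomial.induction_on' with
  | add p q hp hq => rw [map_add, map_add, hp, hq]
  | monomial n a => simp only [← C_mul_X_pow_eq_monomial, Derivation.leibniz,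
      Derivation.leibniz_pow, hC, hX]

/-- A derivation of `A[X]` preserving the constants restricts to a derivation of `A`. -/
noncomputable def restrictConstants (D : Derivation K A[X] A[X])
    (hD : ∀ a, D (C a) ∈ Set.range (C : A → A[X])) : Derivation K A A :=
  Derivation.mk' (lcoeff A 0 |>.restrictScalars K |>.comp <|
      (D : A[X] →ₗ[K] A[X]).comp (CAlgHom (R := K) (A := A)).toLinearMap) fun a b => by
    obtain ⟨x, hx⟩ := hD a
    obtain ⟨y, hy⟩ := hD b
    simp [Derivation.leibniz, ← hx, ← hy]

theorem C_restrictConstants (D : Derivation K A[X] A[X])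
    (hD : ∀ a, D (C a) ∈ Set.range (C : A → A[X])) (a : A) :
    C (restrictConstants D hD a) = D (C a) := by
  obtain ⟨x, hx⟩ := hD a
  simp [restrictConstants, ← hx]

end Polynomial

namespace IsPairDerivation

variable {K A : Type*} [CommRing K] [CommRing A] [Algebra K A]
  {h h' : Derivation K A A} {u u' : A →ₗ[K] A}

theorem apply_eq_s10 (hu : IsPairDerivation h u) (a : A) : u a = h a + a * u 1 := by
  simpa using hu a 1

theorem add_mulRight (h : Derivation K A A) (c : A) :
    IsPairDerivation h ((h : A →ₗ[K] A) + LinearMap.mulRight K c) := fun a b => by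
  simp only [LinearMap.add_apply, Derivation.coeFn_coe, Derivation.leibniz, smul_eq_mul,
    LinearMap.mulRight_apply]
  ring

end IsPairDerivation

/-- The map `Ψ` sending `(h,u) ∈ D(A,A)` to the unique `K`-derivation of `A[X]` with
`C a ↦ C (h a)` and `X ↦ C (u 1) · X` is a bijection from `D(A,A)` onto
`L = {D ∈ Der_K(A[X]) : D(C(A)) ⊆ C(A), D X ∈ C(A)·X}` preserving the Lie brackets:
it is an isomorphism of `K`-Lie algebras (and of `A`-modules) from `D(A,A)` onto `L`. -/
theorem pairDerivation_equiv_logDerivations {K A : Type*} [Field K] [CharZero K] [CommRing A]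
    [Algebra K A]
    (Ψ : Derivation K A A × (A →ₗ[K] A) → Derivation K A[X] A[X])
    (hΨ : ∀ p : Derivation K A A × (A →ₗ[K] A),
      (∀ a : A, Ψ p (C a) = C (p.1 a)) ∧ Ψ p (X : A[X]) = C (p.2 1) * X) :
    Set.InjOn Ψ {p | IsPairDerivation p.1 p.2} ∧
    Ψ '' {p | IsPairDerivation p.1 p.2} = {D : Derivation K A[X] A[X] |
      (∀ a : A, D (C a) ∈ Set.range (C : A → A[X])) ∧ ∃ a : A, D (X : A[X]) = C a * X} ∧
    (∀ (h h' : Derivation K A A) (u u' : A →ₗ[K] A),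
      IsPairDerivation h u → IsPairDerivation h' u' →
        Ψ (⁅h, h'⁆, u ∘ₗ u' - u' ∘ₗ u) = ⁅Ψ (h, u), Ψ (h', u')⁆) := by
  refine ⟨?_, ?_, ?_⟩
  · rintro ⟨h, u⟩ hu ⟨h', u'⟩ hu' e
    have hh : h = h' := by
      ext a
      apply C_injective
      rw [← (hΨ (h, u)).1 a, e, (hΨ (h', u')).1 a]
    have h1 : u 1 = u' 1 := by
      have := congrArg (fun D : Derivation K A[X] A[X] => (D X).coeff 1) e
      simpa [(hΨ _).2] using this
    subst hh
    refine Prod.ext rfl (LinearMap.ext fun a => ?_)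
    exact (hu.apply_eq_s10 a).trans ((congrArg (h a + a * ·) h1).trans (hu'.apply_eq_s10 a).symm)
  · ext D
    constructor
    · rintro ⟨p, -, rfl⟩
      exact ⟨fun a => ⟨p.1 a, ((hΨ p).1 a).symm⟩, p.2 1, (hΨ p).2⟩
    · rintro ⟨hC, c, hX⟩
      refine ⟨(restrictConstants D hC, _), IsPairDerivation.add_mulRight _ c,
        derivation_ext_C_X (fun a => ?_) ?_⟩
      · rw [(hΨ _).1, C_restrictConstants]
      · simp [(hΨ _).2, hX]
  · intro h h' u u' hu hu'
    refine derivation_ext_C_X (fun a => ?_) ?_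
    · simp [Derivation.commutator_apply, (hΨ _).1]
    · simp only [Derivation.commutator_apply, (hΨ _).1, (hΨ _).2, Derivation.leibniz, smul_eq_mul,
        LinearMap.sub_apply, LinearMap.comp_apply, hu.apply_eq_s10 (u' 1), hu'.apply_eq_s10 (u 1),
        map_sub, map_add, map_mul]
      ring
end
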